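/- Let θ1, θ2, θ3, θ4 > 0 with θ1 + θ2 + θ3 + θ4 = π and set a_i = cot θ_i. Then 3(a1a2 + a2a3 + a3a4 + a4a1) + 4(a1a3 + a2a4) ≥ 20, and equality holds if and only if θ1 = θ2 = θ3 = θ4 = π/4. -/

import Mathlib

open Real

theorem cot_add_cot {x y : ℝ} (hx : sin x ≠ 0) (hy : sin y ≠ 0) :
    Real.cot x + Real.cot y = sin (x + y) / (sin x * sin y) := by
  rw [Real.cot_eq_cos_div_sin, Real.cot_eq_cos_div_sin, sin_add]
  field_simp
  ring

theorem cot_add_cot_pos {x y : ℝ} (hx : 0 < x) (hy : 0 < y) (hxy : x + y < π) :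
    0 < Real.cot x + Real.cot y := by
  have sx : 0 < sin x := sin_pos_of_pos_of_lt_pi hx (by linarith)
  have sy : 0 < sin y := sin_pos_of_pos_of_lt_pi hy (by linarith)
  have sxy : 0 < sin (x + y) := sin_pos_of_pos_of_lt_pi (by linarith) hxy
  rw [cot_add_cot sx.ne' sy.ne']
  positivity

theorem cot_mul_cot {x y : ℝ} (hx : sin x ≠ 0) (hy : sin y ≠ 0) (hxy : sin (x + y) ≠ 0) :
    Real.cot x * Real.cot y = 1 + Real.cot (x + y) * (Real.cot x + Real.cot y) := by
  rw [cot_add_cot hx hy, Real.cot_eq_cos_div_sin, Real.cot_eq_cos_div_sin, Real.cot_eq_cos_div_sin]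
  field_simp
  rw [cos_add]
  ring

theorem cot_pi_sub (x : ℝ) : Real.cot (π - x) = -Real.cot x := by
  rw [Real.cot_eq_cos_div_sin, Real.cot_eq_cos_div_sin, cos_pi_sub, sin_pi_sub, neg_div]

theorem cot_pi_div_four : Real.cot (π / 4) = 1 := by
  rw [Real.cot_eq_cos_div_sin, cos_pi_div_four, sin_pi_div_four]
  exact div_self (by positivity)

theorem eq_pi_div_four_of_cot_eq_one {x : ℝ} (hx : 0 < x) (hx' : x < π)
    (h : Real.cot x = 1) : x = π / 4 := by
  have sx : 0 < sin x := sin_pos_of_pos_of_lt_pi hx hx'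
  rw [Real.cot_eq_cos_div_sin, div_eq_one_iff_eq sx.ne'] at h
  have h0 : sin (x - π / 4) = 0 := by
    rw [sin_sub, cos_pi_div_four, sin_pi_div_four, h]
    ring
  have := (sin_eq_zero_iff_of_lt_of_lt (by linarith) (by linarith)).1 h0
  linarith

/-- A positive `p` lies above the positive root of `p² - 4cp - 4`. -/
theorem two_mul_add_sqrt_le {c p : ℝ} (hp : 0 < p) (h : 0 ≤ p ^ 2 - 4 * c * p - 4) :
    2 * (c + √(1 + c ^ 2)) ≤ p := by
  have hw : √(1 + c ^ 2) ^ 2 = 1 + c ^ 2 := sq_sqrt (by positivity)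
  have hcw : c < √(1 + c ^ 2) := lt_sqrt_of_sq_lt (by linarith)
  by_contra! hlt
  nlinarith [mul_pos (sub_pos.2 hlt)
    (show 0 < p + 2 * (√(1 + c ^ 2) - c) by linarith)]

theorem quad_symmetric_ge_twenty (θ1 θ2 θ3 θ4 : ℝ)
    (h1 : 0 < θ1) (h2 : 0 < θ2) (h3 : 0 < θ3) (h4 : 0 < θ4)
    (hsum : θ1 + θ2 + θ3 + θ4 = Real.pi)
    (a1 a2 a3 a4 : ℝ) (ha1 : a1 = Real.cot θ1) (ha2 : a2 = Real.cot θ2)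
    (ha3 : a3 = Real.cot θ3) (ha4 : a4 = Real.cot θ4) :
    20 ≤ 3 * (a1 * a2 + a2 * a3 + a3 * a4 + a4 * a1) + 4 * (a1 * a3 + a2 * a4) ∧
    (3 * (a1 * a2 + a2 * a3 + a3 * a4 + a4 * a1) + 4 * (a1 * a3 + a2 * a4) = 20 ↔
      θ1 = Real.pi / 4 ∧ θ2 = Real.pi / 4 ∧ θ3 = Real.pi / 4 ∧ θ4 = Real.pi / 4) := by
  have sin_ne : ∀ x : ℝ, 0 < x → x < π → sin x ≠ 0 :=
    fun x hx hx' => (sin_pos_of_pos_of_lt_pi hx hx').ne'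
  have hp := cot_add_cot_pos h1 h3 (by linarith)
  have hr := cot_add_cot_pos h2 h4 (by linarith)
  have hq := cot_mul_cot (sin_ne θ1 h1 (by linarith)) (sin_ne θ3 h3 (by linarith))
    (sin_ne (θ1 + θ3) (by linarith) (by linarith))
  have hs := cot_mul_cot (sin_ne θ2 h2 (by linarith)) (sin_ne θ4 h4 (by linarith))
    (sin_ne (θ2 + θ4) (by linarith) (by linarith))
  rw [show θ2 + θ4 = π - (θ1 + θ3) by linarith, cot_pi_sub] at hs
  rw [← ha1, ← ha3] at hp hq
  rw [← ha2, ← ha4] at hr hs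
  set c := Real.cot (θ1 + θ3)
  have hp0 := two_mul_add_sqrt_le (c := c) hp (by nlinarith [sq_nonneg (a1 - a3)])
  have hr0 := two_mul_add_sqrt_le (c := -c) hr (by nlinarith [sq_nonneg (a2 - a4)])
  rw [neg_sq] at hr0
  have hw : √(1 + c ^ 2) ^ 2 = 1 + c ^ 2 := sq_sqrt (by positivity)
  have hcw : |c| < √(1 + c ^ 2) := by
    rw [← sqrt_sq_eq_abs]
    exact sqrt_lt_sqrt (sq_nonneg c) (by linarith)
  obtain ⟨hcw1, hcw2⟩ := abs_lt.1 hcw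
  set w := √(1 + c ^ 2) with hw_def
  have hA : 0 < 3 * (a2 + a4) + 4 * c := by linarith
  have hB : 0 < 6 * w + 2 * c := by linarith
  have key : 3 * (a1 * a2 + a2 * a3 + a3 * a4 + a4 * a1) + 4 * (a1 * a3 + a2 * a4) =
      20 + (a1 + a3 - 2 * (c + w)) * (3 * (a2 + a4) + 4 * c)
        + (a2 + a4 - 2 * (-c + w)) * (6 * w + 2 * c) + 16 * c ^ 2 := by
    linear_combination 4 * hq + 4 * hs + 12 * hw
  have hX := mul_nonneg (sub_nonneg.2 hp0) hA.le
  have hY := mul_nonneg (sub_nonneg.2 hr0) hB.le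
  have hc2 := sq_nonneg c
  refine ⟨by linarith, fun h => ?_, ?_⟩
  · rw [key] at h
    have hc : c = 0 := by
      have : c ^ 2 = 0 := by linarith
      simpa using this
    have hw1 : w = 1 := by rw [hw_def, hc]; simp
    have hX0 : (a1 + a3 - 2 * (c + w)) * (3 * (a2 + a4) + 4 * c) = 0 := by
      linarith
    have hY0 : (a2 + a4 - 2 * (-c + w)) * (6 * w + 2 * c) = 0 := by
      linarith
    have hx := (mul_eq_zero.1 hX0).resolve_right hA.ne'
    have hy := (mul_eq_zero.1 hY0).resolve_right hB.ne'
    rw [hc, hw1] at hx hy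
    rw [hc] at hq hs
    have eq_one : ∀ x y : ℝ, x + y = 2 → x * y = 1 → x = 1 := by
      intro x y hadd hmul
      have : (x - 1) ^ 2 = 0 := by linear_combination x * hadd - hmul
      linarith [pow_eq_zero_iff two_ne_zero |>.1 this]
    have e1 : a1 = 1 := eq_one a1 a3 (by linarith) (by linarith)
    have e2 : a2 = 1 := eq_one a2 a4 (by linarith) (by linarith)
    exact ⟨eq_pi_div_four_of_cot_eq_one h1 (by linarith) (by linarith),
      eq_pi_div_four_of_cot_eq_one h2 (by linarith) (by linarith),
      eq_pi_div_four_of_cot_eq_one h3 (by linarith) (by linarith),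
      eq_pi_div_four_of_cot_eq_one h4 (by linarith) (by linarith)⟩
  · rintro ⟨e1, e2, e3, e4⟩
    rw [ha1, ha2, ha3, ha4, e1, e2, e3, e4, cot_pi_div_four]
    norm_num
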